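/- (A priori bounds on the principal eigenvalue, Lemma 3.7.) For every z ∈ ℤ^d and r > 0: max_{y∈B_r(z)} ( ξ(y) − σ(y)^{−1} ) ≤ λ_r(z) ≤ max_{y∈B_r(z)} ξ(y). -/

import Mathlib

open MeasureTheory ProbabilityTheory Filter Set

namespace BAM

/-- The lattice `ℤ^d`. -/
abbrev V (d : ℕ) : Type := Fin d → ℤ

/-- The `ℓ¹`-norm on `ℤ^d`, as a real number. -/
noncomputable def l1 {d : ℕ} (x : V d) : ℝ := ∑ i, |(x i : ℝ)|

/-- The `ℓ¹`-ball of radius `r` around `z`. -/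
def lball {d : ℕ} (z : V d) (r : ℝ) : Set (V d) := {x | l1 (x - z) ≤ r}

/-- The `i`-th coordinate unit vector. -/
def unitVec {d : ℕ} (i : Fin d) : V d := fun j => if j = i then 1 else 0

/-- The discrete Laplacian `(Δ f)(z) = (2d)⁻¹ Σ_{|y-z|=1} (f y - f z)`. -/
noncomputable def discLap {d : ℕ} (f : V d → ℝ) (z : V d) : ℝ :=
  (2 * (d : ℝ))⁻¹ * ∑ i : Fin d, ((f (z + unitVec i) - f z) + (f (z - unitVec i) - f z))

/-- The Bouchaud–Anderson operator `Δ σ⁻¹ + ξ` acting on `f`. -/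
noncomputable def bamOp {d : ℕ} (σf ξf : V d → ℝ) (f : V d → ℝ) (z : V d) : ℝ :=
  discLap (fun y => f y / σf y) z + ξf z * f z

/-- `lam` is an eigenvalue of the Dirichlet restriction of `Δ σ⁻¹ + ξ` to `S`. -/
def IsDirEV {d : ℕ} (σf ξf : V d → ℝ) (S : Set (V d)) (lam : ℝ) : Prop :=
  ∃ f : V d → ℝ, f ≠ 0 ∧ (∀ x ∉ S, f x = 0) ∧ ∀ x ∈ S, bamOp σf ξf f x = lam * f x

/-- The principal (largest) Dirichlet eigenvalue of `Δ σ⁻¹ + ξ` in `S`. -/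
noncomputable def prinEV {d : ℕ} (σf ξf : V d → ℝ) (S : Set (V d)) : ℝ :=
  sSup {lam | IsDirEV σf ξf S lam}

/-- Weak lexicographic order on `ℤ^d`. -/
def lexLe {d : ℕ} (x y : V d) : Prop :=
  x = y ∨ ∃ i : Fin d, (∀ j, j < i → x j = y j) ∧ x i < y i

/-- Upper tail of `ξ(0)`: `P(ξ(0) > r)` as a real number. -/
noncomputable def tailXi {Ω : Type*} [MeasurableSpace Ω] (P : Measure Ω) (ξ0 : Ω → ℝ) (r : ℝ) : ℝ :=
  (P {ω | r < ξ0 ω}).toReal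

/-- The function `F(r) = ln (− ln P(ξ(0) > r))` from Assumption (A.1). -/
noncomputable def Ffun {Ω : Type*} [MeasurableSpace Ω] (P : Measure Ω) (ξ0 : Ω → ℝ) (r : ℝ) : ℝ :=
  Real.log (-Real.log (tailXi P ξ0 r))

/-- Scale `a_t := inf {u > 1 : − ln P(ξ(0) > u) ≥ d ln t}`. -/
noncomputable def aScale {Ω : Type*} [MeasurableSpace Ω] (P : Measure Ω) (ξ0 : Ω → ℝ)
    (d : ℕ) (t : ℝ) : ℝ :=
  sInf {u : ℝ | 1 < u ∧ (d : ℝ) * Real.log t ≤ -Real.log (tailXi P ξ0 u)}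

noncomputable def log2 (t : ℝ) : ℝ := Real.log (Real.log t)
noncomputable def log3 (t : ℝ) : ℝ := Real.log (Real.log (Real.log t))

/-- The macrobox scale `L_t := t ln₂ t`. -/
noncomputable def Lscale (t : ℝ) : ℝ := t * log2 t

/-- `d_t := ρ/(d ln t)`. -/
noncomputable def dscale (ρ : ℝ) (d : ℕ) (t : ℝ) : ℝ := ρ / (d * Real.log t)

/-- `r_t := t d_t / ln₃ t`. -/
noncomputable def rscale (ρ : ℝ) (d : ℕ) (t : ℝ) : ℝ := t * dscale ρ d t / log3 t

/-- The set `Π_{L,η}` of high exceedances of the potential (in realisation `ξω`). -/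
noncomputable def PiSet {d : ℕ} {Ω : Type*} [MeasurableSpace Ω] (P : Measure Ω)
    (ξ : V d → Ω → ℝ) (ω : Ω) (L η : ℝ) : Set (V d) :=
  {x ∈ lball (0 : V d) L | aScale P (ξ 0) d L - η < ξ x ω}

/-- Solution property for the Cauchy problem of the BAM. -/
def IsSolution {d : ℕ} (σf ξf : V d → ℝ) (v : ℝ → V d → ℝ) : Prop :=
  (∀ t ≥ (0 : ℝ), ∀ z, 0 ≤ v t z) ∧
  (∀ z, v 0 z = if z = 0 then 1 else 0) ∧
  (∀ z : V d, ∀ t > (0 : ℝ),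
    HasDerivAt (fun s => v s z) (discLap (fun y => v t y / σf y) z + ξf z * v t z) t)

theorem exists_diag_le_eigenvalues {n : Type*} [Fintype n] [DecidableEq n]
    {A : Matrix n n ℝ} (hA : A.IsHermitian) (y : n) : ∃ i, A y y ≤ hA.eigenvalues i := by
  by_contra! hlt
  have horth : ∀ x, ∑ i, hA.eigenvectorBasis i x * hA.eigenvectorBasis i y =
      if x = y then 1 else 0 := by
    intro x
    have h := congrFun (congrFun (Unitary.coe_mul_star_self hA.eigenvectorUnitary) x) y
    simpa [Matrix.mul_apply, Matrix.star_apply, Matrix.one_apply,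
      Matrix.IsHermitian.eigenvectorUnitary_apply] using h
  have hdiag : ∑ i, hA.eigenvalues i * (hA.eigenvectorBasis i y) ^ 2 = A y y := by
    have heig : ∀ i, hA.eigenvalues i * hA.eigenvectorBasis i y =
        ∑ x, A y x * hA.eigenvectorBasis i x := fun i =>
      (congrFun (hA.mulVec_eigenvectorBasis i) y).symm
    calc _ = ∑ i, ∑ x, A y x * (hA.eigenvectorBasis i x * hA.eigenvectorBasis i y) := by
          refine Finset.sum_congr rfl fun i _ => ?_
          rw [sq, ← mul_assoc, heig, Finset.sum_mul]
          simp only [mul_assoc]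
      _ = ∑ x, A y x * ∑ i, hA.eigenvectorBasis i x * hA.eigenvectorBasis i y := by
          rw [Finset.sum_comm]
          simp only [Finset.mul_sum]
      _ = A y y := by simp [horth]
  have hone : ∑ i, (hA.eigenvectorBasis i y) ^ 2 = 1 := by simpa [sq] using horth y
  have hzero : ∑ i, (A y y - hA.eigenvalues i) * (hA.eigenvectorBasis i y) ^ 2 = 0 := by
    simp only [sub_mul, Finset.sum_sub_distrib, ← Finset.mul_sum, hdiag, hone, mul_one, sub_self]
  have hsq : ∀ i, (hA.eigenvectorBasis i y) ^ 2 = 0 := fun i =>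
    (mul_eq_zero.1 ((Finset.sum_eq_zero_iff_of_nonneg fun j _ =>
      mul_nonneg (sub_pos.2 (hlt j)).le (sq_nonneg _)).1 hzero i (Finset.mem_univ i))).resolve_left
      (sub_pos.2 (hlt i)).ne'
  simp [hsq] at hone

theorem finite_lball {d : ℕ} (z : V d) (r : ℝ) : (lball z r).Finite := by
  refine (Set.finite_Icc (fun i => z i - ⌈r⌉) (fun i => z i + ⌈r⌉)).subset fun x hx => ?_
  have h : ∀ i, |x i - z i| ≤ ⌈r⌉ := by
    intro i
    have h1 : |((x - z) i : ℝ)| ≤ l1 (x - z) :=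
      Finset.single_le_sum (f := fun i => |((x - z) i : ℝ)|) (fun j _ => abs_nonneg _)
        (Finset.mem_univ i)
    have h2 : |((x - z) i : ℝ)| ≤ ⌈r⌉ := (h1.trans hx).trans (Int.le_ceil r)
    exact_mod_cast h2
  exact ⟨fun i => by have := abs_le.1 (h i); dsimp only; linarith,
    fun i => by have := abs_le.1 (h i); dsimp only; linarith⟩

theorem discLap_eq {d : ℕ} (hd : 1 ≤ d) (f : V d → ℝ) (x : V d) :
    discLap f x = (2 * (d : ℝ))⁻¹ * ∑ i, (f (x + unitVec i) + f (x - unitVec i)) - f x := by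
  have hd0 : (d : ℝ) ≠ 0 := by positivity
  have h : ∀ i, (f (x + unitVec i) - f x) + (f (x - unitVec i) - f x) =
      (f (x + unitVec i) + f (x - unitVec i)) - 2 * f x := fun i => by ring
  simp only [discLap, h, Finset.sum_sub_distrib, Finset.sum_const, Finset.card_univ,
    Fintype.card_fin, nsmul_eq_mul]
  field_simp

theorem discLap_nonpos_of_forall_le {d : ℕ} {f : V d → ℝ} {x : V d} (h : ∀ y, f y ≤ f x) :
    discLap f x ≤ 0 :=
  mul_nonpos_of_nonneg_of_nonpos (by positivity) <|
    Finset.sum_nonpos fun _ _ => add_nonpos (sub_nonpos.2 (h _)) (sub_nonpos.2 (h _))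

theorem bamOp_neg {d : ℕ} (σf ξf f : V d → ℝ) (x : V d) :
    bamOp σf ξf (-f) x = -bamOp σf ξf f x := by
  simp only [bamOp, discLap, Pi.neg_apply, neg_div]
  rw [neg_add, ← mul_neg, ← mul_neg, ← Finset.sum_neg_distrib]
  congr 2
  exact Finset.sum_congr rfl fun i _ => by ring

/-- Every Dirichlet eigenvalue is at most the potential at a maximiser of `|f| / σ`, where `f` is
an associated eigenfunction. -/
theorem IsDirEV.exists_le {d : ℕ} {σf ξf : V d → ℝ} (hσ : ∀ x, 0 < σf x) {S : Set (V d)}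
    (hS : S.Finite) {lam : ℝ} (hlam : IsDirEV σf ξf S lam) : ∃ x ∈ S, lam ≤ ξf x := by
  obtain ⟨f, hf0, hfS, hf⟩ := hlam
  obtain ⟨y, hy⟩ : ∃ y, f y ≠ 0 := Function.ne_iff.1 hf0
  have hyS : y ∈ S := by_contra fun h => hy (hfS y h)
  obtain ⟨x, hxS, hmax⟩ := Set.exists_max_image S (fun x => |f x / σf x|) hS ⟨y, hyS⟩
  have hx0 : f x ≠ 0 := by
    intro h
    have h1 := hmax y hyS
    simp only [h, zero_div, abs_zero, abs_nonpos_iff, div_eq_zero_iff, hy, (hσ y).ne',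
      or_self] at h1
  have key : ∀ g : V d → ℝ, 0 < g x → (∀ w ∉ S, g w = 0) → bamOp σf ξf g x = lam * g x →
      (∀ w ∈ S, g w / σf w ≤ g x / σf x) → lam ≤ ξf x := by
    intro g hgx hgS hg hle
    have hle' : ∀ w, g w / σf w ≤ g x / σf x := by
      intro w
      by_cases hw : w ∈ S
      · exact hle w hw
      · rw [hgS w hw, zero_div]
        exact (div_pos hgx (hσ x)).le
    have h1 := discLap_nonpos_of_forall_le (f := fun w => g w / σf w) hle'
    rw [bamOp] at hg
    exact le_of_mul_le_mul_right (by linarith) hgx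
  refine ⟨x, hxS, ?_⟩
  rcases lt_or_gt_of_ne hx0 with hneg | hpos
  · refine key (-f) (neg_pos.2 hneg) (fun w hw => by simp [hfS w hw])
      (by rw [bamOp_neg, hf x hxS, Pi.neg_apply, mul_neg]) fun w hw => ?_
    have h1 := hmax w hw
    rw [abs_of_neg (div_neg_of_neg_of_pos hneg (hσ x))] at h1
    simpa only [Pi.neg_apply, neg_div] using (neg_le_abs _).trans h1
  · refine key f hpos hfS (hf x hxS) fun w hw => ?_
    have h1 := hmax w hw
    rw [abs_of_pos (div_pos hpos (hσ x))] at h1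
    exact (le_abs_self _).trans h1

/-- The number of lattice steps from `x` to `y`. -/
noncomputable def stepCount {d : ℕ} (x y : V d) : ℝ :=
  ∑ i, ((if y = x + unitVec i then 1 else 0) + (if y = x - unitVec i then 1 else 0))

theorem stepCount_comm {d : ℕ} (x y : V d) : stepCount x y = stepCount y x := by
  refine Finset.sum_congr rfl fun i _ => ?_
  rw [add_comm]
  simp only [eq_sub_iff_add_eq, eq_comm]

theorem stepCount_self {d : ℕ} (x : V d) : stepCount x x = 0 := by
  have h : ∀ i : Fin d, unitVec i ≠ 0 := fun i hi => by simpa [unitVec] using congrFun hi i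
  have h' : ∀ i : Fin d, x ≠ x - unitVec i := fun i hi => h i (sub_eq_self.1 hi.symm)
  simp [stepCount, h, h']

theorem sum_stepCount_mul {d : ℕ} {S : Set (V d)} [Fintype S] {f : V d → ℝ}
    (hf : ∀ x ∉ S, f x = 0) (x : V d) :
    ∑ y : S, stepCount x y * f y = ∑ i, (f (x + unitVec i) + f (x - unitVec i)) := by
  classical
  have hsingle : ∀ w, ∑ y : S, (if (y : V d) = w then 1 else 0) * f y = f w := by
    intro w
    by_cases hw : w ∈ S
    · rw [Finset.sum_eq_single (⟨w, hw⟩ : S)]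
      · simp
      · intro b _ hb
        rw [if_neg fun h => hb (Subtype.ext h), zero_mul]
      · simp
    · rw [hf w hw]
      exact Finset.sum_eq_zero fun y _ => by
        rw [if_neg fun h : (y : V d) = w => hw (h ▸ y.2), zero_mul]
  simp only [stepCount, Finset.sum_mul]
  rw [Finset.sum_comm]
  simp only [add_mul, Finset.sum_add_distrib, hsingle]

/-- The matrix of the Dirichlet restriction of `Δ σ⁻¹ + ξ` to `S`, conjugated by `√σ`. -/
noncomputable def symMatrix {d : ℕ} (σf ξf : V d → ℝ) (S : Set (V d)) : Matrix S S ℝ :=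
  Matrix.of fun x y => (√(σf x))⁻¹ * ((2 * (d : ℝ))⁻¹ * stepCount (x : V d) y) * (√(σf y))⁻¹ +
    Matrix.diagonal (fun x : S => ξf x - (σf x)⁻¹) x y

theorem symMatrix_isHermitian {d : ℕ} (σf ξf : V d → ℝ) (S : Set (V d)) :
    (symMatrix σf ξf S).IsHermitian := by
  ext x y
  have h := congrFun (congrFun
    (Matrix.diagonal_transpose fun x : S => ξf x - (σf x)⁻¹) x) y
  rw [Matrix.transpose_apply] at h
  simp only [symMatrix, Matrix.conjTranspose_apply, Matrix.of_apply, star_trivial, h,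
    stepCount_comm (y : V d) x]
  ring

theorem symMatrix_diag {d : ℕ} (σf ξf : V d → ℝ) (S : Set (V d)) (x : S) :
    symMatrix σf ξf S x x = ξf x - (σf x)⁻¹ := by
  simp [symMatrix, stepCount_self]

theorem isDirEV_of_symMatrix_mulVec {d : ℕ} (hd : 1 ≤ d) {σf ξf : V d → ℝ}
    (hσ : ∀ x, 0 < σf x) {S : Set (V d)} [Fintype S] {v : S → ℝ} (hv : v ≠ 0) {lam : ℝ}
    (h : (symMatrix σf ξf S).mulVec v = lam • v) : IsDirEV σf ξf S lam := by
  classical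
  have hs : ∀ x, √(σf x) ≠ 0 := fun x => (Real.sqrt_pos.2 (hσ x)).ne'
  let f : V d → ℝ := fun x => if hx : x ∈ S then √(σf x) * v ⟨x, hx⟩ else 0
  have hfS : ∀ x : S, f x = √(σf x) * v x := fun x => dif_pos x.2
  have hf0 : ∀ x ∉ S, f x = 0 := fun x hx => dif_neg hx
  refine ⟨f, fun hf => hv (funext fun x => ?_), hf0, fun x hx => ?_⟩
  · have h1 := hfS x
    rw [hf] at h1
    exact (mul_eq_zero.1 h1.symm).resolve_left (hs x)
  · have hg : ∀ y : S, f y / σf y = (√(σf y))⁻¹ * v y := by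
      intro y
      rw [hfS, mul_div_right_comm, Real.sqrt_div_self]
    have hsum := sum_stepCount_mul (S := S) (f := fun y => f y / σf y)
      (fun y hy => by simp [hf0 y hy]) x
    have hrow := congrFun h ⟨x, hx⟩
    simp only [Matrix.mulVec, dotProduct, symMatrix, Matrix.of_apply, add_mul,
      Finset.sum_add_distrib, Pi.smul_apply, smul_eq_mul, Matrix.diagonal_apply, ite_mul, zero_mul,
      Finset.sum_ite_eq, Finset.mem_univ, if_true] at hrow
    have hstep : ∑ y : S, (√(σf x))⁻¹ * ((2 * (d : ℝ))⁻¹ * stepCount x y) * (√(σf y))⁻¹ * v y =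
        (√(σf x))⁻¹ * ((2 * (d : ℝ))⁻¹ * ∑ y : S, stepCount x y * (f y / σf y)) := by
      simp only [Finset.mul_sum, hg]
      exact Finset.sum_congr rfl fun y _ => by ring
    rw [hstep, hsum] at hrow
    have hfx : f x = √(σf x) * v ⟨x, hx⟩ := hfS ⟨x, hx⟩
    rw [bamOp, discLap_eq hd]
    have h2 := congrArg (√(σf x) * ·) hrow
    simp only [mul_add, mul_inv_cancel_left₀ (hs x)] at h2
    rw [div_eq_mul_inv (f x), hfx]
    linarith

theorem exists_isDirEV_ge {d : ℕ} (hd : 1 ≤ d) {σf ξf : V d → ℝ} (hσ : ∀ x, 0 < σf x)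
    {S : Set (V d)} (hS : S.Finite) {y : V d} (hy : y ∈ S) :
    ∃ lam, IsDirEV σf ξf S lam ∧ ξf y - (σf y)⁻¹ ≤ lam := by
  classical
  have := hS.fintype
  have hA := symMatrix_isHermitian σf ξf S
  obtain ⟨i, hi⟩ := exists_diag_le_eigenvalues hA ⟨y, hy⟩
  rw [symMatrix_diag] at hi
  refine ⟨_, isDirEV_of_symMatrix_mulVec hd hσ (fun h => ?_) (hA.mulVec_eigenvectorBasis i), hi⟩
  exact hA.eigenvectorBasis.orthonormal.ne_zero i (PiLp.ext fun j => congrFun h j)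

/-- Lemma 3.7 (A priori bounds on the principal eigenvalue):
`max_{y ∈ B_r(z)} (ξ(y) − σ(y)⁻¹) ≤ λ_r(z) ≤ max_{y ∈ B_r(z)} ξ(y)`. -/
theorem apriori_bounds_principal_eigenvalue
    (d : ℕ) (hd : 1 ≤ d)
    (σf ξf : V d → ℝ) (hσpos : ∀ x, 0 < σf x)
    (z : V d) (r : ℝ) (hr : 0 < r) :
    sSup ((fun y => ξf y - (σf y)⁻¹) '' lball z r) ≤ prinEV σf ξf (lball z r) ∧
    prinEV σf ξf (lball z r) ≤ sSup (ξf '' lball z r) := by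
  have hfin := finite_lball z r
  have hz : z ∈ lball z r := by simpa [lball, l1] using hr.le
  have hle : ∀ lam ∈ {lam | IsDirEV σf ξf (lball z r) lam}, lam ≤ sSup (ξf '' lball z r) := by
    intro lam hlam
    obtain ⟨x, hx, hxl⟩ := IsDirEV.exists_le hσpos hfin hlam
    exact hxl.trans (le_csSup (hfin.image ξf).bddAbove (mem_image_of_mem ξf hx))
  constructor
  · refine csSup_le (Set.Nonempty.image _ ⟨z, hz⟩) ?_
    rintro _ ⟨y, hy, rfl⟩
    obtain ⟨lam, hlam, hyl⟩ := exists_isDirEV_ge (ξf := ξf) hd hσpos hfin hy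
    exact hyl.trans (le_csSup ⟨_, hle⟩ hlam)
  · obtain ⟨lam, hlam, -⟩ := exists_isDirEV_ge (ξf := ξf) hd hσpos hfin hz
    exact csSup_le ⟨lam, hlam⟩ hle

end BAM
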